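/- For every d ≥ 1 and every d×d real symmetric matrix E, lim_{ε→0⁺} (1/ε²)·dist²(I + εE, SO(d)) = ‖E‖², where dist is taken with respect to the Frobenius norm ‖·‖ on d×d matrices. -/

import Mathlib

open Matrix Filter Topology

noncomputable section

/-- Frobenius norm of a real `d × d` matrix. -/
def frob {d : ℕ} (F : Matrix (Fin d) (Fin d) ℝ) : ℝ :=
  Real.sqrt (∑ i, ∑ j, (F i j) ^ 2)

/-- Distance (w.r.t. the Frobenius norm) from a matrix to a set of matrices. -/
def fdist {d : ℕ} (F : Matrix (Fin d) (Fin d) ℝ)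
    (S : Set (Matrix (Fin d) (Fin d) ℝ)) : ℝ :=
  sInf ((fun G => frob (F - G)) '' S)

/-- The special orthogonal group `SO(d)` as a set of matrices. -/
def SOd (d : ℕ) : Set (Matrix (Fin d) (Fin d) ℝ) :=
  {R | R * Rᵀ = 1 ∧ R.det = 1}

/-- The squared Frobenius norm is the sum of the squared entries. -/
theorem frob_sq {d : ℕ} (F : Matrix (Fin d) (Fin d) ℝ) :
    frob F ^ 2 = ∑ i, ∑ j, (F i j) ^ 2 :=
  Real.sq_sqrt (Finset.sum_nonneg fun _ _ => Finset.sum_nonneg fun _ _ => sq_nonneg _)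

theorem frob_nonneg {d : ℕ} (F : Matrix (Fin d) (Fin d) ℝ) : 0 ≤ frob F :=
  Real.sqrt_nonneg _

theorem frob_smul {d : ℕ} {c : ℝ} (hc : 0 ≤ c) (F : Matrix (Fin d) (Fin d) ℝ) :
    frob (c • F) = c * frob F := by
  refine (sq_eq_sq₀ (frob_nonneg _) (mul_nonneg hc (frob_nonneg _))).mp ?_
  rw [mul_pow, frob_sq, frob_sq]
  simp only [Matrix.smul_apply, smul_eq_mul, mul_pow, Finset.mul_sum]

/-- Every entry of the Gram matrix `N * Nᵀ` is bounded by the squared Frobenius norm of `N`. -/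
theorem abs_mul_transpose_apply_le {d : ℕ} (N : Matrix (Fin d) (Fin d) ℝ) (i j : Fin d) :
    |(N * Nᵀ) i j| ≤ frob N ^ 2 := by
  have row (i : Fin d) : ∑ k, (N i k) ^ 2 ≤ frob N ^ 2 := by
    rw [frob_sq]
    exact Finset.single_le_sum (f := fun i => ∑ k, (N i k) ^ 2)
      (fun _ _ => Finset.sum_nonneg fun _ _ => sq_nonneg _) (Finset.mem_univ i)
  have hi := row i
  have hj := row j
  calc |(N * Nᵀ) i j| ≤ ∑ k, |N i k * N j k| := by
        rw [Matrix.mul_apply]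
        exact Finset.abs_sum_le_sum_abs _ _
    _ ≤ ∑ k, ((N i k) ^ 2 + (N j k) ^ 2) / 2 := by
        refine Finset.sum_le_sum fun k _ => abs_le.mpr ⟨?_, ?_⟩
        · nlinarith [sq_nonneg (N i k + N j k)]
        · nlinarith [sq_nonneg (N i k - N j k)]
    _ = (∑ k, (N i k) ^ 2 + ∑ k, (N j k) ^ 2) / 2 := by
        rw [← Finset.sum_div, Finset.sum_add_distrib]
    _ ≤ frob N ^ 2 := by linarith

/-- For `E` symmetric and `R` orthogonal, pairing `E` with `1 - R` amounts to pairing it with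
the Gram matrix of `1 - R`. -/
theorem two_mul_sum_mul_one_sub {d : ℕ} {E R : Matrix (Fin d) (Fin d) ℝ} (hE : E.IsSymm)
    (hR : R * Rᵀ = 1) :
    2 * ∑ i, ∑ j, E i j * (1 - R) i j =
      ∑ i, ∑ j, E i j * ((1 - R) * (1 - R)ᵀ : Matrix (Fin d) (Fin d) ℝ) i j := by
  have hN : (1 - R) * (1 - R)ᵀ = (1 - R) + (1 - R)ᵀ := by
    rw [Matrix.transpose_sub, Matrix.transpose_one, sub_mul, mul_sub, mul_sub, hR]
    simp only [one_mul, mul_one]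
    abel
  have hT : ∑ i, ∑ j, E i j * (1 - R)ᵀ i j = ∑ i, ∑ j, E i j * (1 - R) i j := by
    rw [Finset.sum_comm]
    refine Finset.sum_congr rfl fun i _ => Finset.sum_congr rfl fun j _ => ?_
    rw [Matrix.transpose_apply, hE.apply]
  simp only [hN, Matrix.add_apply, mul_add, Finset.sum_add_distrib, hT]
  ring

/-- When `ε` is small relative to the symmetric matrix `E`, no orthogonal matrix is closer to
`1 + ε • E` than the identity. -/
theorem frob_smul_le_frob_sub {d : ℕ} {E R : Matrix (Fin d) (Fin d) ℝ} (hE : E.IsSymm)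
    (hR : R * Rᵀ = 1) {ε : ℝ} (hε : 0 ≤ ε) (hεE : ε * ∑ i, ∑ j, |E i j| ≤ 1) :
    frob (ε • E) ≤ frob (1 + ε • E - R) := by
  refine (sq_le_sq₀ (frob_nonneg _) (frob_nonneg _)).mp ?_
  have expand : frob (1 + ε • E - R) ^ 2 = frob (1 - R) ^ 2
      + ε * (2 * ∑ i, ∑ j, E i j * (1 - R) i j) + frob (ε • E) ^ 2 := by
    simp only [frob_sq, Finset.mul_sum, ← Finset.sum_add_distrib]
    refine Finset.sum_congr rfl fun i _ => Finset.sum_congr rfl fun j _ => ?_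
    simp only [Matrix.sub_apply, Matrix.add_apply, Matrix.smul_apply, smul_eq_mul]
    ring
  have lower : -((∑ i, ∑ j, |E i j|) * frob (1 - R) ^ 2) ≤
      ∑ i, ∑ j, E i j * ((1 - R) * (1 - R)ᵀ : Matrix (Fin d) (Fin d) ℝ) i j := by
    simp only [Finset.sum_mul, ← Finset.sum_neg_distrib]
    refine Finset.sum_le_sum fun i _ => Finset.sum_le_sum fun j _ => ?_
    refine (neg_le_neg ?_).trans (neg_abs_le _)
    rw [abs_mul]
    exact mul_le_mul_of_nonneg_left (abs_mul_transpose_apply_le _ i j) (abs_nonneg _)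
  rw [expand, two_mul_sum_mul_one_sub hE hR]
  nlinarith [mul_le_mul_of_nonneg_left lower hε,
    mul_le_mul_of_nonneg_right hεE (sq_nonneg (frob (1 - R)))]

/-- For small `ε`, the distance from `1 + ε • E` to `SO(d)` is attained at the identity. -/
theorem fdist_one_add_smul {d : ℕ} {E : Matrix (Fin d) (Fin d) ℝ} (hE : E.IsSymm)
    {ε : ℝ} (hε : 0 ≤ ε) (hεE : ε * ∑ i, ∑ j, |E i j| ≤ 1) :
    fdist (1 + ε • E) (SOd d) = ε * frob E := by
  rw [← frob_smul hε]
  refine IsLeast.csInf_eq ⟨⟨1, by simp [SOd], by simp⟩, ?_⟩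
  rintro _ ⟨R, hR, rfl⟩
  exact frob_smul_le_frob_sub hE hR.1 hε hεE

/-- for every `d ≥ 1` and every symmetric `E`,
`(1/ε²) dist²(I + εE, SO(d)) → ‖E‖²` as `ε → 0⁺`, with `dist` and `‖·‖` the Frobenius ones. -/
theorem dist_sq_SO_limit (d : ℕ) (hd : 1 ≤ d)
    (E : Matrix (Fin d) (Fin d) ℝ) (hE : E.IsSymm) :
    Tendsto (fun ε : ℝ => (1 / ε ^ 2) * (fdist (1 + ε • E) (SOd d)) ^ 2)
      (𝓝[>] 0) (𝓝 ((frob E) ^ 2)) := by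
  have small : ∀ᶠ ε : ℝ in 𝓝[>] 0, ε * ∑ i, ∑ j, |E i j| < 1 := by
    have h : Tendsto (fun ε : ℝ => ε * ∑ i, ∑ j, |E i j|) (𝓝 0) (𝓝 0) :=
      Continuous.tendsto' (by fun_prop) _ _ (zero_mul _)
    exact (h.mono_left nhdsWithin_le_nhds).eventually_lt_const one_pos
  refine tendsto_const_nhds.congr' ?_
  filter_upwards [small, self_mem_nhdsWithin] with ε hε hpos
  have hpos : 0 < ε := hpos
  rw [fdist_one_add_smul hE hpos.le hε.le]
  field_simp
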